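/- arXiv:1011.6165 — 2 statements merged into one kernel-verified Lean document; each statement's English description precedes it below -/
import Mathlib

section
/- Let F and G be distribution functions of probability measures on ℝ. Then for all real a < b and every natural number N ≥ 1, with a_k = a + (b − a)·k/N for k = 0,…,N, one has ∫_a^b |F(x) − G(x)| dx ≤ Σ_{k=1}^N | ∫_{a_{k−1}}^{a_k} (F(x) − G(x)) dx | + 2(b − a)/N. -/
open MeasureTheory

/-- On `[c, d]` the difference of two monotone functions oscillates by at most the sum of their
increments, which bounds the loss in `|∫ (F - G)| ≤ ∫ |F - G|`. -/
theorem Monotone.integral_abs_sub_le {F G : ℝ → ℝ} (hF : Monotone F) (hG : Monotone G)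
    {c d : ℝ} (hcd : c < d) :
    ∫ x in c..d, |F x - G x| ≤
      |∫ x in c..d, (F x - G x)| + (d - c) * ((F d - F c) + (G d - G c)) := by
  have hL : 0 < d - c := sub_pos.2 hcd
  have hint : IntervalIntegrable (fun x => F x - G x) volume c d :=
    hF.intervalIntegrable.sub hG.intervalIntegrable
  have hpt : ∀ x ∈ Set.Icc c d, |F x - G x| ≤
      |∫ y in c..d, (F y - G y)| / (d - c) + ((F d - F c) + (G d - G c)) := by
    intro x hx
    have hosc : ‖∫ y in c..d, ((F x - G x) - (F y - G y))‖ ≤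
        ((F d - F c) + (G d - G c)) * |d - c| := by
      refine intervalIntegral.norm_integral_le_of_norm_le_const fun y hy => ?_
      rw [Set.uIoc_of_le hcd.le] at hy
      rw [Real.norm_eq_abs, abs_le]
      constructor <;>
        linarith [hF hx.1, hF hx.2, hG hx.1, hG hx.2, hF hy.1.le, hF hy.2, hG hy.1.le, hG hy.2]
    rw [intervalIntegral.integral_sub intervalIntegrable_const hint,
      intervalIntegral.integral_const, smul_eq_mul, Real.norm_eq_abs, abs_of_pos hL] at hosc
    have htri := abs_sub_abs_le_abs_sub ((d - c) * (F x - G x)) (∫ y in c..d, (F y - G y))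
    rw [abs_mul, abs_of_pos hL] at htri
    rw [← sub_le_iff_le_add, le_div_iff₀ hL]
    linarith
  calc ∫ x in c..d, |F x - G x|
      ≤ ∫ _ in c..d, (|∫ y in c..d, (F y - G y)| / (d - c) + ((F d - F c) + (G d - G c))) :=
        intervalIntegral.integral_mono_on hcd.le hint.abs intervalIntegrable_const hpt
    _ = _ := by
        rw [intervalIntegral.integral_const, smul_eq_mul, mul_add, mul_div_cancel₀ _ hL.ne']

/-- Lemma 3.1: for distribution functions `F`, `G` (nondecreasing, right-continuous,
with limits 0 at −∞ and 1 at +∞), all `a < b` and `N ≥ 1`, with `aₖ = a + (b − a)k/N`,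
`∫_a^b |F − G| ≤ Σ_{k=1}^N |∫_{a_{k−1}}^{a_k} (F − G)| + 2(b − a)/N`. -/
theorem stmt9 (F G : ℝ → ℝ)
    (hFmono : Monotone F) (hGmono : Monotone G)
    (hFrc : ∀ x, ContinuousWithinAt F (Set.Ici x) x)
    (hGrc : ∀ x, ContinuousWithinAt G (Set.Ici x) x)
    (hF0 : Filter.Tendsto F Filter.atBot (nhds 0))
    (hF1 : Filter.Tendsto F Filter.atTop (nhds 1))
    (hG0 : Filter.Tendsto G Filter.atBot (nhds 0))
    (hG1 : Filter.Tendsto G Filter.atTop (nhds 1))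
    (a b : ℝ) (hab : a < b) (N : ℕ) (hN : 1 ≤ N) :
    ∫ x in a..b, |F x - G x| ≤
      (∑ k ∈ Finset.Icc 1 N,
        |∫ x in (a + (b - a) * ((k : ℝ) - 1) / N)..(a + (b - a) * (k : ℝ) / N),
          (F x - G x)|) + 2 * (b - a) / N := by
  have hN0 : (0 : ℝ) < N := by exact_mod_cast hN
  set p : ℕ → ℝ := fun k => a + (b - a) * (k : ℝ) / N with hp
  have hp0 : p 0 = a := by simp [hp]
  have hpN : p N = b := by simp only [hp]; field_simp; ring
  have hstep : ∀ k, p (k + 1) - p k = (b - a) / N := by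
    intro k
    simp only [hp]
    push_cast
    ring
  have hlt : ∀ k, p k < p (k + 1) := fun k =>
    sub_pos.1 (by rw [hstep]; exact div_pos (sub_pos.2 hab) hN0)
  have hsplit := intervalIntegral.sum_integral_adjacent_intervals (μ := volume) (a := p) (n := N)
    (f := fun x => |F x - G x|)
    fun k _ => (hFmono.intervalIntegrable.sub hGmono.intervalIntegrable).abs
  rw [hp0, hpN] at hsplit
  have hreindex : ∑ k ∈ Finset.Icc 1 N,
      |∫ x in (a + (b - a) * ((k : ℝ) - 1) / N)..(a + (b - a) * (k : ℝ) / N), (F x - G x)| =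
      ∑ k ∈ Finset.range N, |∫ x in p k..p (k + 1), (F x - G x)| := by
    rw [Finset.range_eq_Ico, ← Finset.Ico_add_one_right_eq_Icc,
      ← Finset.sum_Ico_add' _ 0 N 1]
    simp [hp]
  have htel : ∑ k ∈ Finset.range N,
      (p (k + 1) - p k) * ((F (p (k + 1)) - F (p k)) + (G (p (k + 1)) - G (p k))) =
      (b - a) / N * ((F b - F a) + (G b - G a)) := by
    simp only [hstep]
    rw [← Finset.mul_sum, Finset.sum_add_distrib, Finset.sum_range_sub (fun k => F (p k)),
      Finset.sum_range_sub (fun k => G (p k)), hp0, hpN]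
  have hinc : (F b - F a) + (G b - G a) ≤ 2 := by
    linarith [hFmono.ge_of_tendsto hF1 b, hFmono.le_of_tendsto hF0 a,
      hGmono.ge_of_tendsto hG1 b, hGmono.le_of_tendsto hG0 a]
  rw [hreindex, ← hsplit]
  calc ∑ k ∈ Finset.range N, ∫ x in p k..p (k + 1), |F x - G x|
      ≤ ∑ k ∈ Finset.range N, (|∫ x in p k..p (k + 1), (F x - G x)| +
          (p (k + 1) - p k) * ((F (p (k + 1)) - F (p k)) + (G (p (k + 1)) - G (p k)))) :=
        Finset.sum_le_sum fun k _ => hFmono.integral_abs_sub_le hGmono (hlt k)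
    _ = ∑ k ∈ Finset.range N, |∫ x in p k..p (k + 1), (F x - G x)| +
          (b - a) / N * ((F b - F a) + (G b - G a)) := by
        rw [Finset.sum_add_distrib, htel]
    _ ≤ _ := by
        have := mul_le_mul_of_nonneg_left hinc (div_pos (sub_pos.2 hab) hN0).le
        rw [mul_comm 2, mul_div_right_comm]
        gcongr
end

section
/- Let (X₁,…,Xₙ) be a random vector in ℝⁿ with E|Xᵢ| < ∞ for all i, let X₁* ≤ … ≤ Xₙ* denote its ordered statistics, and let Fₙ be the associated empirical distribution function with mean F = E Fₙ. Then (1/(2n)) Σ_{i=1}^n E|Xᵢ* − E Xᵢ*| ≤ E W₁(Fₙ, F) ≤ (2/n) Σ_{i=1}^n E|Xᵢ* − E Xᵢ*|. -/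
open MeasureTheory

/-- Empirical distribution function of the values `v : Fin n → ℝ`. -/
noncomputable def empDF {n : ℕ} (v : Fin n → ℝ) (x : ℝ) : ℝ :=
  (Finset.univ.filter fun i => v i ≤ x).card / n

/-- Ordered statistics: the values `v₁, …, vₙ` arranged in nondecreasing order. -/
noncomputable def orderStat {n : ℕ} (v : Fin n → ℝ) : Fin n → ℝ :=
  v ∘ Tuple.sort v

/-- The unit step at `a`, that is, the distribution function of the Dirac mass at `a`. -/
noncomputable def unitStep (a x : ℝ) : ℝ := if a ≤ x then 1 else 0

/-- The truncation of `t - i` to the interval `[0, 1]`. -/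
noncomputable def unitClamp (i : ℕ) (t : ℝ) : ℝ := max 0 (min 1 (t - i))

theorem unitStep_sub_eq (a b : ℝ) :
    (fun x => unitStep a x - unitStep b x) =
      fun x => (Set.Ico a b).indicator 1 x - (Set.Ico b a).indicator 1 x := by
  funext x
  simp only [unitStep, Set.indicator, Set.mem_Ico, Pi.one_apply]
  grind

theorem abs_unitStep_sub_eq (a b : ℝ) :
    (fun x => |unitStep a x - unitStep b x|) =
      fun x => (Set.Ico a b).indicator 1 x + (Set.Ico b a).indicator 1 x := by
  funext x
  simp only [unitStep, Set.indicator, Set.mem_Ico, Pi.one_apply]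
  grind

theorem integrable_indicator_Ico_one (a b : ℝ) :
    Integrable ((Set.Ico a b).indicator (1 : ℝ → ℝ)) := by
  rw [integrable_indicator_iff measurableSet_Ico]
  exact integrableOn_const (by simp)

theorem integrable_unitStep_sub (a b : ℝ) :
    Integrable (fun x => unitStep a x - unitStep b x) := by
  rw [unitStep_sub_eq]
  exact (integrable_indicator_Ico_one a b).sub (integrable_indicator_Ico_one b a)

theorem integral_unitStep_sub (a b : ℝ) :
    ∫ x, (unitStep a x - unitStep b x) = b - a := by
  rw [unitStep_sub_eq, integral_sub (integrable_indicator_Ico_one a b)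
    (integrable_indicator_Ico_one b a), integral_indicator_one measurableSet_Ico,
    integral_indicator_one measurableSet_Ico]
  simp only [Measure.real, Real.volume_Ico, ENNReal.toReal_ofReal']
  grind

theorem integral_abs_unitStep_sub (a b : ℝ) :
    ∫ x, |unitStep a x - unitStep b x| = |a - b| := by
  rw [abs_unitStep_sub_eq, integral_add (integrable_indicator_Ico_one a b)
    (integrable_indicator_Ico_one b a), integral_indicator_one measurableSet_Ico,
    integral_indicator_one measurableSet_Ico]
  simp only [Measure.real, Real.volume_Ico, ENNReal.toReal_ofReal']
  grind

theorem Measurable.unitStep {α : Type*} [MeasurableSpace α] {f g : α → ℝ}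
    (hf : Measurable f) (hg : Measurable g) : Measurable fun z => unitStep (f z) (g z) :=
  Measurable.ite (measurableSet_le hf hg) measurable_const measurable_const

theorem unitClamp_mono (i : ℕ) : Monotone (unitClamp i) := by
  intro s t h
  unfold unitClamp
  gcongr

theorem measurable_unitClamp (i : ℕ) : Measurable (unitClamp i) :=
  (unitClamp_mono i).measurable

theorem sum_range_unitClamp {t : ℝ} (ht : 0 ≤ t) (m : ℕ) :
    ∑ i ∈ Finset.range m, unitClamp i t = min t m := by
  induction m with
  | zero => simp [ht]
  | succ m ih =>
    rw [Finset.sum_range_succ, ih, unitClamp]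
    push_cast
    grind

theorem abs_sub_eq_sum_abs_unitClamp {n : ℕ} {s t : ℝ} (hs : 0 ≤ s) (hsn : s ≤ n)
    (ht : 0 ≤ t) (htn : t ≤ n) :
    |s - t| = ∑ i : Fin n, |unitClamp i s - unitClamp i t| := by
  wlog h : s ≤ t generalizing s t
  · rw [abs_sub_comm, this ht htn hs hsn (le_of_not_ge h)]
    exact Finset.sum_congr rfl fun i _ => abs_sub_comm _ _
  have hsum {u : ℝ} (hu : 0 ≤ u) (hun : u ≤ n) : ∑ i : Fin n, unitClamp i u = u := by
    rw [← Finset.sum_range fun i => unitClamp i u, sum_range_unitClamp hu, min_eq_left hun]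
  calc |s - t| = t - s := by rw [abs_sub_comm, abs_of_nonneg (sub_nonneg.2 h)]
    _ = ∑ i : Fin n, (unitClamp i t - unitClamp i s) := by
      rw [Finset.sum_sub_distrib, hsum ht htn, hsum hs hsn]
    _ = _ := Finset.sum_congr rfl fun i _ => by
      rw [abs_sub_comm, abs_of_nonneg (sub_nonneg.2 (unitClamp_mono i h))]

theorem unitClamp_natCast (i k : ℕ) : unitClamp i k = if i < k then 1 else 0 := by
  unfold unitClamp
  split_ifs with h
  · have : (i : ℝ) + 1 ≤ k := by exact_mod_cast h
    grind
  · have : (k : ℝ) ≤ i := by exact_mod_cast not_lt.1 h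
    grind

section OrderStat

variable {n : ℕ} (v : Fin n → ℝ)

theorem card_filter_orderStat_le (x : ℝ) :
    (Finset.univ.filter fun i => orderStat v i ≤ x).card =
      (Finset.univ.filter fun i => v i ≤ x).card := by
  refine Finset.card_equiv (Tuple.sort v) fun i => ?_
  rw [Finset.mem_filter_univ, Finset.mem_filter_univ]
  rfl

theorem orderStat_le_iff (i : Fin n) (x : ℝ) :
    orderStat v i ≤ x ↔ (i : ℕ) < (Finset.univ.filter fun j => v j ≤ x).card := by
  rw [← card_filter_orderStat_le]
  exact (Tuple.lt_card_le_iff_apply_le_of_monotone (Tuple.monotone_sort v)).symm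

theorem mul_empDF (hn : 0 < n) (x : ℝ) :
    n * empDF v x = (Finset.univ.filter fun i => v i ≤ x).card := by
  unfold empDF
  field_simp

theorem unitStep_orderStat (hn : 0 < n) (i : Fin n) (x : ℝ) :
    unitStep (orderStat v i) x = unitClamp i (n * empDF v x) := by
  rw [mul_empDF v hn, unitClamp_natCast, unitStep]
  simp only [orderStat_le_iff]

theorem empDF_nonneg (x : ℝ) : 0 ≤ empDF v x := by
  unfold empDF
  positivity

theorem empDF_le_one (x : ℝ) : empDF v x ≤ 1 :=
  div_le_one_of_le₀ (by
    exact_mod_cast (Finset.card_filter_le _ _).trans_eq (by simp)) (by positivity)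

theorem empDF_eq_sum_unitStep_div (x : ℝ) : empDF v x = (∑ i, unitStep (v i) x) / n := by
  simp [empDF, unitStep]

theorem empDF_eq_sum_unitStep_orderStat_div (x : ℝ) :
    empDF v x = (∑ i, unitStep (orderStat v i) x) / n := by
  rw [empDF, ← card_filter_orderStat_le]
  simp [unitStep]

theorem measurable_orderStat (i : Fin n) : Measurable fun v : Fin n → ℝ => orderStat v i := by
  refine measurable_of_Iic fun x => ?_
  have hm : Measurable fun v : Fin n → ℝ => ∑ j, if v j ≤ x then 1 else 0 :=
    Finset.measurable_fun_sum _ fun j _ =>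
      Measurable.ite (measurableSet_le (measurable_pi_apply j) measurable_const)
        measurable_const measurable_const
  convert measurableSet_lt (measurable_const (a := (i : ℕ))) hm using 1
  ext v
  simp [orderStat_le_iff]

theorem abs_orderStat_le (i : Fin n) : |orderStat v i| ≤ ∑ j, |v j| :=
  Finset.single_le_sum (f := fun j => |v j|) (fun _ _ => abs_nonneg _)
    (Finset.mem_univ (Tuple.sort v i))

end OrderStat

section RandomVector

variable {n : ℕ} {Ω : Type*} [MeasurableSpace Ω] {P : Measure Ω} {X : Ω → Fin n → ℝ}

theorem integrable_orderStat (hX : Measurable X) (hint : ∀ i, Integrable (fun ω => X ω i) P)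
    (i : Fin n) : Integrable (fun ω => orderStat (X ω) i) P :=
  (integrable_finsetSum Finset.univ fun j _ => (hint j).abs).mono'
    ((measurable_orderStat i).comp hX).aestronglyMeasurable
    (Filter.Eventually.of_forall fun ω => abs_orderStat_le (X ω) i)

theorem measurable_uncurry_empDF (hX : Measurable X) :
    Measurable fun z : Ω × ℝ => empDF (X z.1) z.2 := by
  simp only [empDF_eq_sum_unitStep_div]
  exact (Finset.measurable_fun_sum _ fun i _ =>
    ((measurable_pi_apply i).comp (hX.comp measurable_fst)).unitStep measurable_snd).div_const _

theorem integrable_empDF [IsFiniteMeasure P] (hX : Measurable X) (x : ℝ) :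
    Integrable (fun ω => empDF (X ω) x) P :=
  Integrable.of_bound
    ((measurable_uncurry_empDF hX).comp measurable_prodMk_right).aestronglyMeasurable 1
    (Filter.Eventually.of_forall fun ω => by
      rw [Real.norm_of_nonneg (empDF_nonneg _ _)]
      exact empDF_le_one _ _)

theorem measurable_integral_empDF [SFinite P] (hX : Measurable X) :
    Measurable fun x => ∫ ω, empDF (X ω) x ∂P :=
  (StronglyMeasurable.integral_prod_left'
    (measurable_uncurry_empDF hX).stronglyMeasurable).measurable

theorem integrable_unitStep_sub_prod [IsFiniteMeasure P] {Y : Ω → ℝ} (hY : Measurable Y)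
    (hYint : Integrable Y P) (c : ℝ) :
    Integrable (fun z : Ω × ℝ => unitStep (Y z.1) z.2 - unitStep c z.2) (P.prod volume) := by
  have hm : Measurable fun z : Ω × ℝ => unitStep (Y z.1) z.2 - unitStep c z.2 :=
    ((hY.comp measurable_fst).unitStep measurable_snd).sub
      (measurable_const.unitStep measurable_snd)
  refine (integrable_prod_iff hm.aestronglyMeasurable).2
    ⟨Filter.Eventually.of_forall fun ω => integrable_unitStep_sub (Y ω) c, ?_⟩
  simp only [Real.norm_eq_abs, integral_abs_unitStep_sub]
  exact (hYint.sub (integrable_const c)).abs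

theorem integral_abs_unitStep_sub_prod [IsFiniteMeasure P] {Y : Ω → ℝ} (hY : Measurable Y)
    (hYint : Integrable Y P) (c : ℝ) :
    ∫ z : Ω × ℝ, |unitStep (Y z.1) z.2 - unitStep c z.2| ∂(P.prod volume) =
      ∫ ω, |Y ω - c| ∂P := by
  rw [integral_prod _ (integrable_unitStep_sub_prod hY hYint c).abs]
  simp only [integral_abs_unitStep_sub]

/-- Centering at the mean costs at most twice the cost of centering anywhere else. -/
theorem integral_abs_sub_integral_le [IsProbabilityMeasure P] {Y : Ω → ℝ}
    (hY : Integrable Y P) (b : ℝ) :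
    ∫ ω, |Y ω - ∫ ω', Y ω' ∂P| ∂P ≤ 2 * ∫ ω, |Y ω - b| ∂P := by
  set c := ∫ ω', Y ω' ∂P
  have hb : Integrable (fun ω => |Y ω - b|) P := (hY.sub (integrable_const b)).abs
  have hcb : |c - b| ≤ ∫ ω, |Y ω - b| ∂P := by
    have : c - b = ∫ ω, (Y ω - b) ∂P := by
      rw [integral_sub hY (integrable_const b)]
      simp [c]
    rw [this]
    exact abs_integral_le_integral_abs
  calc ∫ ω, |Y ω - c| ∂P ≤ ∫ ω, (|Y ω - b| + |c - b|) ∂P :=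
        integral_mono (hY.sub (integrable_const c)).abs (hb.add (integrable_const _)) fun ω => by
          simpa [abs_sub_comm] using abs_sub_le (Y ω) b c
    _ = (∫ ω, |Y ω - b| ∂P) + |c - b| := by
        rw [integral_add hb (integrable_const _)]
        simp
    _ ≤ _ := by linarith

/-- Integrability of `Fₙ - F` on the product space, together with the bound of its `L¹` norm by
the distance from the order statistics to arbitrary constants `c`. -/
theorem integrable_empDF_sub_and_integral_le [IsProbabilityMeasure P] (hX : Measurable X)
    (hint : ∀ i, Integrable (fun ω => X ω i) P) (c : Fin n → ℝ) :
    Integrable (fun z : Ω × ℝ => empDF (X z.1) z.2 - ∫ ω', empDF (X ω') z.2 ∂P)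
        (P.prod volume) ∧
      ∫ z : Ω × ℝ, |empDF (X z.1) z.2 - ∫ ω', empDF (X ω') z.2 ∂P| ∂(P.prod volume) ≤
        (2 / n : ℝ) * ∑ i, ∫ ω, |orderStat (X ω) i - c i| ∂P := by
  have hYm (i : Fin n) : Measurable fun ω => orderStat (X ω) i := (measurable_orderStat i).comp hX
  have hY := integrable_orderStat hX hint
  set H : ℝ → ℝ := fun x => (∑ i, unitStep (c i) x) / n
  set K : Ω × ℝ → ℝ := fun z => empDF (X z.1) z.2 - H z.2
  have hKsum : K = fun z => (∑ i, (unitStep (orderStat (X z.1) i) z.2 - unitStep (c i) z.2)) / n := by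
    funext z
    simp only [K, H, empDF_eq_sum_unitStep_orderStat_div, Finset.sum_sub_distrib, sub_div]
  have hterm (i : Fin n) := integrable_unitStep_sub_prod (hYm i) (hY i) (c i)
  have hKint : Integrable K (P.prod volume) := by
    rw [hKsum]
    exact (integrable_finsetSum _ fun i _ => hterm i).div_const _
  have hKle : ∫ z, |K z| ∂(P.prod volume) ≤
      (1 / n : ℝ) * ∑ i, ∫ ω, |orderStat (X ω) i - c i| ∂P := by
    simp only [← fun i => integral_abs_unitStep_sub_prod (hYm i) (hY i) (c i)]
    rw [← integral_finsetSum _ fun i _ => (hterm i).abs, ← integral_const_mul]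
    refine integral_mono hKint.abs
      ((integrable_finsetSum _ fun i _ => (hterm i).abs).const_mul _) fun z => ?_
    simp only [hKsum]
    rw [abs_div, Nat.abs_cast, div_eq_inv_mul, one_div]
    gcongr
    exact Finset.abs_sum_le_sum_abs _ _
  have hmean (x : ℝ) : ∫ ω, K (ω, x) ∂P = (∫ ω, empDF (X ω) x ∂P) - H x := by
    simp only [K]
    rw [integral_sub (integrable_empDF hX x) (integrable_const _)]
    simp
  have hM : Integrable fun x => ∫ ω, K (ω, x) ∂P := hKint.integral_prod_right
  have hMle : ∫ x, |∫ ω, K (ω, x) ∂P| ≤ ∫ z, |K z| ∂(P.prod volume) := by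
    rw [integral_prod_symm _ hKint.abs]
    exact integral_mono hM.abs hKint.abs.integral_prod_right fun x => abs_integral_le_integral_abs
  have hM2 : Integrable (fun z : Ω × ℝ => ∫ ω, K (ω, z.2) ∂P) (P.prod volume) := hM.comp_snd P
  have hD : (fun z : Ω × ℝ => empDF (X z.1) z.2 - ∫ ω', empDF (X ω') z.2 ∂P) =
      fun z => K z - ∫ ω, K (ω, z.2) ∂P := by
    funext z
    rw [hmean]
    simp only [K]
    ring
  have hDint := hKint.sub hM2
  refine ⟨by rw [hD]; exact hDint, ?_⟩
  have hsnd : ∫ z : Ω × ℝ, |∫ ω, K (ω, z.2) ∂P| ∂(P.prod volume) = ∫ x, |∫ ω, K (ω, x) ∂P| := by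
    rw [integral_prod _ hM2.abs]
    simp
  calc ∫ z : Ω × ℝ, |empDF (X z.1) z.2 - ∫ ω', empDF (X ω') z.2 ∂P| ∂(P.prod volume)
      = ∫ z, |K z - ∫ ω, K (ω, z.2) ∂P| ∂(P.prod volume) := by
        simp only [fun z => congrFun hD z]
    _ ≤ ∫ z, (|K z| + |∫ ω, K (ω, z.2) ∂P|) ∂(P.prod volume) :=
        integral_mono hDint.abs (hKint.abs.add hM2.abs) fun z => abs_sub _ _
    _ = (∫ z, |K z| ∂(P.prod volume)) + ∫ x, |∫ ω, K (ω, x) ∂P| := by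
        rw [integral_add hKint.abs hM2.abs, hsnd]
    _ ≤ 2 * ((1 / n : ℝ) * ∑ i, ∫ ω, |orderStat (X ω) i - c i| ∂P) := by linarith
    _ = _ := by ring

end RandomVector

/-- If `F` takes values in `[0, 1]`, then some constants `b i`, the means of the slices of `F`,
satisfy `n⁻¹ ∑ |v₍ᵢ₎ - b i| ≤ W₁(Fₙ, F)` for every sample `v` with `W₁(Fₙ, F)` finite. -/
theorem exists_sum_abs_orderStat_sub_le {n : ℕ} (hn : 0 < n) {F : ℝ → ℝ} (hF : Measurable F)
    (hF0 : ∀ x, 0 ≤ F x) (hF1 : ∀ x, F x ≤ 1) :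
    ∃ b : Fin n → ℝ, ∀ v : Fin n → ℝ, Integrable (fun x => empDF v x - F x) →
      ∑ i, |orderStat v i - b i| ≤ n * ∫ x, |empDF v x - F x| := by
  refine ⟨fun i => ∫ x, (unitStep 0 x - unitClamp i (n * F x)), fun v hv => ?_⟩
  have hscale {u : ℝ} (h : u ≤ 1) : (n : ℝ) * u ≤ n := mul_le_of_le_one_right (by positivity) h
  have hsum (x : ℝ) : n * |empDF v x - F x| =
      ∑ i : Fin n, |unitStep (orderStat v i) x - unitClamp i (n * F x)| := by
    simp only [unitStep_orderStat v hn]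
    rw [← abs_sub_eq_sum_abs_unitClamp (mul_nonneg n.cast_nonneg (empDF_nonneg v x))
      (hscale (empDF_le_one v x)) (mul_nonneg n.cast_nonneg (hF0 x)) (hscale (hF1 x)),
      ← mul_sub, abs_mul, Nat.abs_cast]
  have hslice (i : Fin n) :
      Integrable fun x => unitStep (orderStat v i) x - unitClamp i (n * F x) := by
    refine (hv.abs.const_mul (n : ℝ)).mono' ((measurable_const.unitStep measurable_id).sub
      ((measurable_unitClamp i).comp (hF.const_mul _))).aestronglyMeasurable
      (Filter.Eventually.of_forall fun x => ?_)
    rw [hsum x]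
    exact Finset.single_le_sum
      (f := fun i : Fin n => |unitStep (orderStat v i) x - unitClamp i (n * F x)|)
      (fun _ _ => abs_nonneg _) (Finset.mem_univ i)
  rw [← integral_const_mul]
  simp only [hsum]
  rw [integral_finsetSum _ fun i _ => (hslice i).abs]
  refine Finset.sum_le_sum fun i _ => ?_
  have hmean : ∫ x, (unitStep 0 x - unitClamp i (n * F x)) =
      orderStat v i + ∫ x, (unitStep (orderStat v i) x - unitClamp i (n * F x)) := by
    have h := integral_add (integrable_unitStep_sub 0 (orderStat v i)) (hslice i)
    rw [integral_unitStep_sub] at h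
    simpa using h
  rw [hmean, sub_add_cancel_left, abs_neg]
  exact abs_integral_le_integral_abs

/-- The two-sided bound (1.4): for a random vector `(X₁,…,Xₙ)` with `E|Xᵢ| < ∞`,
`(1/(2n)) Σᵢ E|Xᵢ* − E Xᵢ*| ≤ E W₁(Fₙ, F) ≤ (2/n) Σᵢ E|Xᵢ* − E Xᵢ*|`,
where `W₁(Fₙ, F) = ∫ |Fₙ(x) − F(x)| dx` and `Xᵢ*` are the ordered statistics. -/
theorem stmt13 (n : ℕ) (hn : 0 < n) (Ω : Type) [MeasurableSpace Ω] (P : Measure Ω)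
    [IsProbabilityMeasure P] (X : Ω → Fin n → ℝ) (hX : Measurable X)
    (hint : ∀ i, Integrable (fun ω => X ω i) P) :
    (1 / (2 * n) : ℝ) *
        ∑ i, ∫ ω, |orderStat (X ω) i - ∫ ω', orderStat (X ω') i ∂P| ∂P ≤
      ∫ ω, (∫ x : ℝ, |empDF (X ω) x - ∫ ω', empDF (X ω') x ∂P|) ∂P ∧
    ∫ ω, (∫ x : ℝ, |empDF (X ω) x - ∫ ω', empDF (X ω') x ∂P|) ∂P ≤
      (2 / n : ℝ) *
        ∑ i, ∫ ω, |orderStat (X ω) i - ∫ ω', orderStat (X ω') i ∂P| ∂P := by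
  set c : Fin n → ℝ := fun i => ∫ ω', orderStat (X ω') i ∂P
  obtain ⟨hD, hle⟩ := integrable_empDF_sub_and_integral_le hX hint c
  rw [integral_prod _ hD.abs] at hle
  refine ⟨?_, hle⟩
  have hY := integrable_orderStat hX hint
  obtain ⟨b, hb⟩ := exists_sum_abs_orderStat_sub_le hn (measurable_integral_empDF (P := P) hX)
    (fun x => integral_nonneg fun ω => empDF_nonneg (X ω) x)
    (fun x => by
      simpa using integral_mono (integrable_empDF (P := P) hX x) (integrable_const 1)
        fun ω => empDF_le_one (X ω) x)
  have habs (i : Fin n) : Integrable (fun ω => |orderStat (X ω) i - b i|) P :=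
    ((hY i).sub (integrable_const _)).abs
  have hlower : ∑ i, ∫ ω, |orderStat (X ω) i - b i| ∂P ≤
      n * ∫ ω, (∫ x : ℝ, |empDF (X ω) x - ∫ ω', empDF (X ω') x ∂P|) ∂P := by
    rw [← integral_finsetSum _ fun i _ => habs i, ← integral_const_mul]
    refine integral_mono_ae (integrable_finsetSum _ fun i _ => habs i)
      (hD.abs.integral_prod_left.const_mul _) ?_
    filter_upwards [hD.prod_right_ae] with ω hω using hb _ hω
  have hcenter : ∑ i, ∫ ω, |orderStat (X ω) i - c i| ∂P ≤
      2 * ∑ i, ∫ ω, |orderStat (X ω) i - b i| ∂P := by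
    rw [Finset.mul_sum]
    exact Finset.sum_le_sum fun i _ => integral_abs_sub_integral_le (hY i) (b i)
  rw [div_mul_eq_mul_div, one_mul, div_le_iff₀ (by positivity)]
  linarith
end
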